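/- arXiv:2510.26368 — 8 statements merged into one kernel-verified Lean document; each statement's English description precedes it below -/
import Mathlib

section
/- Let n be a natural number, g₁, g₂ ∈ ℝⁿ fixed vectors, d ∈ ℝ a constant, h : ℝⁿ → ℝⁿ a function, u : ℝ → ℝ a function, and p : ℝⁿ → ℝ a differentiable function. Suppose x : ℝ → ℝⁿ is differentiable and satisfies x'(t) = h(x(t)) + u(t)·g₁ + d·g₂ for all t, and γ : ℝ → ℝ is differentiable and satisfies γ'(t) = -(∇p(x(t))·g₂)·γ(t) - ∇p(x(t))·(p(x(t))·g₂ + h(x(t)) + u(t)·g₁) for all t, where ∇p denotes the gradient of p and · between vectors denotes the Euclidean inner product. Define the disturbance estimate d̂(t) = γ(t) + p(x(t)) and the estimation error d̃(t) = d̂(t) - d. Then d̃ is differentiable and d̃'(t) = -(∇p(x(t))·g₂)·d̃(t) for all t. -/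
open scoped RealInnerProductSpace

/-- Error dynamics of the nonlinear disturbance observer: for the system
`x' = h(x) + u·g₁ + d·g₂` with constant disturbance `d`, the observer state `γ` with
`γ' = -(∇p(x)·g₂)·γ - ∇p(x)·(p(x)·g₂ + h(x) + u·g₁)` and estimate `d̂ = γ + p(x)`
yield an estimation error `d̃ = d̂ - d` satisfying `d̃' = -(∇p(x)·g₂)·d̃`. -/
theorem disturbance_observer_error_dynamics
    (n : ℕ) (g₁ g₂ : EuclideanSpace ℝ (Fin n)) (d : ℝ)
    (h : EuclideanSpace ℝ (Fin n) → EuclideanSpace ℝ (Fin n)) (u : ℝ → ℝ)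
    (p : EuclideanSpace ℝ (Fin n) → ℝ) (hp : Differentiable ℝ p)
    (x : ℝ → EuclideanSpace ℝ (Fin n)) (x' : ℝ → EuclideanSpace ℝ (Fin n))
    (hx : ∀ t, HasDerivAt x (x' t) t)
    (hxeq : ∀ t, x' t = h (x t) + u t • g₁ + d • g₂)
    (γ : ℝ → ℝ)
    (hγ : ∀ t, HasDerivAt γ
      (-(⟪gradient p (x t), g₂⟫) * γ t -
        ⟪gradient p (x t), p (x t) • g₂ + h (x t) + u t • g₁⟫) t)
    (dhat dtil : ℝ → ℝ)
    (hdhat : ∀ t, dhat t = γ t + p (x t))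
    (hdtil : ∀ t, dtil t = dhat t - d) :
    ∀ t, HasDerivAt dtil (-(⟪gradient p (x t), g₂⟫) * dtil t) t := by
  intro t
  have h1 : HasDerivAt (fun s => p (x s)) (⟪gradient p (x t), x' t⟫) t := by
    have h2 := (hp (x t)).hasGradientAt.hasFDerivAt.comp_hasDerivAt t (hx t)
    simpa [Function.comp_def] using h2
  have h3 := ((hγ t).add h1).sub_const d
  have hfun : dtil = fun s => γ s + p (x s) - d := by
    funext s
    rw [hdtil, hdhat]
  have h4 := h3
  change HasDerivAt (fun s => γ s + p (x s) - d) _ t at h4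
  rw [← hfun] at h4
  convert h4 using 1
  rw [hdtil, hdhat, hxeq]
  simp only [inner_add_right, real_inner_smul_right]
  ring
end

section
/- Let n be a natural number, g₁, g₂ ∈ ℝⁿ fixed vectors, d ∈ ℝ a constant, h : ℝⁿ → ℝⁿ a function, u : ℝ → ℝ a function, and p : ℝⁿ → ℝ a differentiable function. Suppose x : ℝ → ℝⁿ is differentiable and satisfies x'(t) = h(x(t)) + u(t)·g₁ + d·g₂ for all t, and γ : ℝ → ℝ is differentiable and satisfies γ'(t) = -(∇p(x(t))·g₂)·γ(t) - ∇p(x(t))·(p(x(t))·g₂ + h(x(t)) + u(t)·g₁) for all t. Define d̂(t) = γ(t) + p(x(t)) and d̃(t) = d̂(t) - d. If there exists λ > 0 such that ∇p(x(t))·g₂ ≥ λ for all t ≥ 0, then |d̃(t)| ≤ |d̃(0)|·exp(-λ·t) for all t ≥ 0; in particular the disturbance estimation error converges to zero exponentially. -/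
open scoped RealInnerProductSpace

/-- Exponential convergence of the nonlinear disturbance observer: if the design
condition `∇p(x(t))·g₂ ≥ λ > 0` holds for all `t ≥ 0`, then the disturbance
estimation error satisfies `|d̃(t)| ≤ |d̃(0)|·exp(-λ·t)` for all `t ≥ 0`. -/
theorem disturbance_observer_exponential_convergence
    (n : ℕ) (g₁ g₂ : EuclideanSpace ℝ (Fin n)) (d : ℝ)
    (h : EuclideanSpace ℝ (Fin n) → EuclideanSpace ℝ (Fin n)) (u : ℝ → ℝ)
    (p : EuclideanSpace ℝ (Fin n) → ℝ) (hp : Differentiable ℝ p)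
    (x : ℝ → EuclideanSpace ℝ (Fin n)) (x' : ℝ → EuclideanSpace ℝ (Fin n))
    (hx : ∀ t, HasDerivAt x (x' t) t)
    (hxeq : ∀ t, x' t = h (x t) + u t • g₁ + d • g₂)
    (γ : ℝ → ℝ)
    (hγ : ∀ t, HasDerivAt γ
      (-(⟪gradient p (x t), g₂⟫) * γ t -
        ⟪gradient p (x t), p (x t) • g₂ + h (x t) + u t • g₁⟫) t)
    (dhat dtil : ℝ → ℝ)
    (hdhat : ∀ t, dhat t = γ t + p (x t))
    (hdtil : ∀ t, dtil t = dhat t - d)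
    (lam : ℝ) (hlam : 0 < lam)
    (hlow : ∀ t, 0 ≤ t → lam ≤ ⟪gradient p (x t), g₂⟫) :
    ∀ t, 0 ≤ t → |dtil t| ≤ |dtil 0| * Real.exp (-lam * t) := by
  have hder : ∀ t, HasDerivAt dtil (-(⟪gradient p (x t), g₂⟫) * dtil t) t := by
    intro t
    have h1 : HasDerivAt (fun s => p (x s)) (⟪gradient p (x t), x' t⟫) t := by
      have h2 := (hp (x t)).hasGradientAt.hasFDerivAt.comp_hasDerivAt t (hx t)
      simpa [Function.comp_def] using h2
    have h3 := ((hγ t).add h1).sub_const d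
    have he : dtil = fun s => (γ + fun s => p (x s)) s - d := by
      funext s
      simp [hdtil, hdhat]
    rw [← he] at h3
    refine HasDerivAt.congr_deriv h3 ?_
    rw [hxeq, hdtil, hdhat]
    simp only [inner_add_right, inner_smul_right]
    ring
  have hV : ∀ t, HasDerivAt (fun s => (dtil s * Real.exp (lam * s)) ^ 2)
      (2 * (lam - ⟪gradient p (x t), g₂⟫) * (dtil t * Real.exp (lam * t)) ^ 2) t := by
    intro t
    have h1 : HasDerivAt (fun s => Real.exp (lam * s)) (Real.exp (lam * t) * (lam * 1)) t :=
      ((hasDerivAt_id t).const_mul lam).exp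
    have h2 := ((hder t).mul h1).pow 2
    refine HasDerivAt.congr_deriv h2 ?_
    simp only [Pi.mul_apply]
    push_cast
    ring
  have hanti : AntitoneOn (fun s => (dtil s * Real.exp (lam * s)) ^ 2) (Set.Ici 0) := by
    apply antitoneOn_of_deriv_nonpos (convex_Ici 0)
    · exact fun t _ => (hV t).continuousAt.continuousWithinAt
    · exact fun t _ => (hV t).differentiableAt.differentiableWithinAt
    · intro t ht
      rw [interior_Ici] at ht
      rw [(hV t).deriv]
      have h1 := hlow t (le_of_lt ht)
      have h2 := sq_nonneg (dtil t * Real.exp (lam * t))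
      exact mul_nonpos_of_nonpos_of_nonneg (by linarith) h2
  intro t ht
  have h1 := hanti (Set.mem_Ici.2 le_rfl) (Set.mem_Ici.2 ht) ht
  have h2 := sq_le_sq.1 h1
  rw [abs_mul, abs_mul, Real.abs_exp, Real.abs_exp, mul_zero, Real.exp_zero, mul_one] at h2
  rw [neg_mul, Real.exp_neg, ← div_eq_mul_inv, le_div_iff₀ (Real.exp_pos _)]
  exact h2
end

section
/- Let τ > 0 and M ≥ 0 be real numbers, let g : ℝ → ℝ be a function with |g(t)| ≤ M for all t ≥ 0, and let e : ℝ → ℝ be differentiable with e(0) = 0 and e'(t) = -e(t)/τ - g(t) for all t ≥ 0. Then |e(t)| ≤ τ·M·(1 - exp(-t/τ)) ≤ τ·M for all t ≥ 0. -/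
/-- First-order command-filter error bound: if `τ > 0`, `M ≥ 0`, `|g(t)| ≤ M` for
`t ≥ 0`, and `e` is differentiable with `e(0) = 0` and `e'(t) = -e(t)/τ - g(t)` for
`t ≥ 0`, then `|e(t)| ≤ τ·M·(1 - exp(-t/τ)) ≤ τ·M` for all `t ≥ 0`. -/
theorem command_filter_error_bound
    (τ M : ℝ) (hτ : 0 < τ) (hM : 0 ≤ M)
    (g : ℝ → ℝ) (hg : ∀ t, 0 ≤ t → |g t| ≤ M)
    (e : ℝ → ℝ) (he0 : e 0 = 0)
    (he : ∀ t, 0 ≤ t → HasDerivAt e (-(e t) / τ - g t) t) :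
    ∀ t, 0 ≤ t →
      |e t| ≤ τ * M * (1 - Real.exp (-t / τ)) ∧
      τ * M * (1 - Real.exp (-t / τ)) ≤ τ * M := by
  intro t ht
  have hE : ∀ s : ℝ, HasDerivAt (fun s => Real.exp (s / τ)) (Real.exp (s / τ) * (1 / τ)) s :=
    fun s => ((hasDerivAt_id s).div_const τ).exp
  have hf : ∀ s, 0 ≤ s → HasDerivAt (fun s => Real.exp (s / τ) * e s)
      (-(Real.exp (s / τ) * g s)) s := by
    intro s hs
    have h := (hE s).mul (he s hs)
    refine h.congr_deriv ?_
    field_simp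
    ring
  have hB : ∀ s, HasDerivAt (fun s => τ * M * (Real.exp (s / τ) - 1))
      (Real.exp (s / τ) * M) s := by
    intro s
    refine (((hE s).sub_const 1).const_mul (τ * M)).congr_deriv ?_
    field_simp
  have key := image_norm_le_of_norm_deriv_right_le_deriv_boundary (a := 0) (b := t)
    (fun s hs => (hf s hs.1).continuousAt.continuousWithinAt)
    (fun s hs => (hf s hs.1).hasDerivWithinAt) (by simp [he0]) hB
    (fun s hs => by
      rw [norm_neg, norm_mul, Real.norm_eq_abs, Real.norm_eq_abs, Real.abs_exp]
      exact mul_le_mul_of_nonneg_left (hg s hs.1) (Real.exp_pos _).le)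
    (Set.right_mem_Icc.2 ht)
  rw [norm_mul, Real.norm_eq_abs, Real.norm_eq_abs, Real.abs_exp] at key
  have hx : Real.exp (t / τ) * Real.exp (-t / τ) = 1 := by
    rw [← Real.exp_add, neg_div, add_neg_cancel, Real.exp_zero]
  constructor
  · refine le_of_mul_le_mul_left (key.trans (le_of_eq ?_)) (Real.exp_pos (t / τ))
    linear_combination (τ * M) * hx
  · have h1 : 0 ≤ τ * M * Real.exp (-t / τ) := by positivity
    linarith
end

section
/- Let p₁, k₁, τ, λ, C, M be positive real numbers. Let ξ₁, ξ₂, e₁, d̃ : ℝ → ℝ be differentiable functions and c, F : ℝ → ℝ functions with |c(t)| ≤ C and |F(t)| ≤ M for all t, such that for all t: ξ₁'(t) = -p₁·ξ₁(t) + ξ₂(t) + e₁(t) + c(t); ξ₂'(t) = -ξ₁(t) - k₁·ξ₂(t) - d̃(t); e₁'(t) = -e₁(t)/τ - F(t); d̃'(t) = -λ·d̃(t). Define V(t) = ½·(ξ₁(t)² + ξ₂(t)² + e₁(t)² + d̃(t)²). Then for all t, V'(t) ≤ -(p₁ - 1)·ξ₁(t)² - (k₁ - ½)·ξ₂(t)²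 - (1/τ - 1)·e₁(t)² - (λ - ½)·d̃(t)² + (C² + M²)/2. -/
/-- Closed-loop Lyapunov derivative inequality for the attitude (roll) loop of the
command-filtered backstepping controller with disturbance observer. -/
theorem attitude_lyapunov_inequality
    (p₁ k₁ τ lam C M : ℝ)
    (hp₁ : 0 < p₁) (hk₁ : 0 < k₁) (hτ : 0 < τ) (hlam : 0 < lam)
    (hC : 0 < C) (hM : 0 < M)
    (ξ₁ ξ₂ e₁ dtil : ℝ → ℝ) (c F : ℝ → ℝ)
    (hc : ∀ t, |c t| ≤ C) (hF : ∀ t, |F t| ≤ M)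
    (hξ₁ : ∀ t, HasDerivAt ξ₁ (-p₁ * ξ₁ t + ξ₂ t + e₁ t + c t) t)
    (hξ₂ : ∀ t, HasDerivAt ξ₂ (-(ξ₁ t) - k₁ * ξ₂ t - dtil t) t)
    (he₁ : ∀ t, HasDerivAt e₁ (-(e₁ t) / τ - F t) t)
    (hdtil : ∀ t, HasDerivAt dtil (-lam * dtil t) t)
    (V : ℝ → ℝ)
    (hV : ∀ t, V t = (1 / 2) * ((ξ₁ t) ^ 2 + (ξ₂ t) ^ 2 + (e₁ t) ^ 2 + (dtil t) ^ 2)) :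
    ∀ t, deriv V t ≤ -(p₁ - 1) * (ξ₁ t) ^ 2 - (k₁ - 1 / 2) * (ξ₂ t) ^ 2
      - (1 / τ - 1) * (e₁ t) ^ 2 - (lam - 1 / 2) * (dtil t) ^ 2 + (C ^ 2 + M ^ 2) / 2 := by
  intro t
  have hVf : V = fun t => (1 / 2) * ((ξ₁ t) ^ 2 + (ξ₂ t) ^ 2 + (e₁ t) ^ 2 + (dtil t) ^ 2) :=
    funext hV
  have hd := (((((hξ₁ t).fun_pow 2).fun_add ((hξ₂ t).fun_pow 2)).fun_add
    ((he₁ t).fun_pow 2)).fun_add ((hdtil t).fun_pow 2)).const_mul (1 / 2 : ℝ)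
  rw [hVf, hd.deriv]
  have h1 : (c t) ^ 2 ≤ C ^ 2 := sq_le_sq' (abs_le.mp (hc t)).1 (abs_le.mp (hc t)).2
  have h2 : (F t) ^ 2 ≤ M ^ 2 := sq_le_sq' (abs_le.mp (hF t)).1 (abs_le.mp (hF t)).2
  have h3 := sq_nonneg (ξ₁ t - e₁ t)
  have h4 := sq_nonneg (ξ₁ t - c t)
  have h5 := sq_nonneg (ξ₂ t + dtil t)
  have h6 := sq_nonneg (e₁ t + F t)
  rw [div_eq_mul_inv (-(e₁ t)) τ, one_div τ]
  norm_num
  nlinarith [h1, h2, h3, h4, h5, h6]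
end

section
/- Let p₁ > 1, k₁ > ½, 0 < τ < 1, λ > ½, and C, M > 0 be real numbers. Let ξ₁, ξ₂, e₁, d̃ : ℝ → ℝ be differentiable functions and c, F : ℝ → ℝ functions with |c(t)| ≤ C and |F(t)| ≤ M for all t, satisfying for all t: ξ₁'(t) = -p₁·ξ₁(t) + ξ₂(t) + e₁(t) + c(t); ξ₂'(t) = -ξ₁(t) - k₁·ξ₂(t) - d̃(t); e₁'(t) = -e₁(t)/τ - F(t); d̃'(t) = -λ·d̃(t). Define V(t) = ½·(ξ₁(t)² + ξ₂(t)² + e₁(t)² + d̃(t)²) and a = 2·min{p₁ - 1, k₁ - ½, 1/τ - 1, λ - ½} > 0. Then for all t ≥ 0, V(t) ≤ V(0)·exp(-a·t) + ((C² + M²)/(2a))·(1 - exp(-a·t)); in particular all four error signals are uniformly ultimately bounded, with limsup_{t→∞} V(t) ≤ (C² + M²)/(2a). -/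
open Filter

/-- Uniform ultimate boundedness of the closed-loop attitude error system
(Theorem 1 of the paper, abstracted): under the gain conditions `p₁ > 1`,
`k₁ > 1/2`, `0 < τ < 1`, `λ > 1/2`, the Lyapunov function satisfies
`V(t) ≤ V(0)·exp(-a·t) + ((C²+M²)/(2a))·(1 - exp(-a·t))` for `t ≥ 0`, and
`limsup_{t→∞} V(t) ≤ (C²+M²)/(2a)`. -/
theorem attitude_uniform_ultimate_boundedness
    (p₁ k₁ τ lam C M : ℝ)
    (hp₁ : 1 < p₁) (hk₁ : 1 / 2 < k₁) (hτ0 : 0 < τ) (hτ1 : τ < 1) (hlam : 1 / 2 < lam)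
    (hC : 0 < C) (hM : 0 < M)
    (ξ₁ ξ₂ e₁ dtil : ℝ → ℝ) (c F : ℝ → ℝ)
    (hc : ∀ t, |c t| ≤ C) (hF : ∀ t, |F t| ≤ M)
    (hξ₁ : ∀ t, HasDerivAt ξ₁ (-p₁ * ξ₁ t + ξ₂ t + e₁ t + c t) t)
    (hξ₂ : ∀ t, HasDerivAt ξ₂ (-(ξ₁ t) - k₁ * ξ₂ t - dtil t) t)
    (he₁ : ∀ t, HasDerivAt e₁ (-(e₁ t) / τ - F t) t)
    (hdtil : ∀ t, HasDerivAt dtil (-lam * dtil t) t)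
    (V : ℝ → ℝ)
    (hV : ∀ t, V t = (1 / 2) * ((ξ₁ t) ^ 2 + (ξ₂ t) ^ 2 + (e₁ t) ^ 2 + (dtil t) ^ 2))
    (a : ℝ)
    (ha : a = 2 * min (min (p₁ - 1) (k₁ - 1 / 2)) (min (1 / τ - 1) (lam - 1 / 2))) :
    0 < a ∧
    (∀ t, 0 ≤ t → V t ≤ V 0 * Real.exp (-a * t)
        + ((C ^ 2 + M ^ 2) / (2 * a)) * (1 - Real.exp (-a * t))) ∧
    limsup V atTop ≤ (C ^ 2 + M ^ 2) / (2 * a) := by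
  have h1 : a / 2 ≤ p₁ - 1 := by
    have : a / 2 = min (min (p₁ - 1) (k₁ - 1 / 2)) (min (1 / τ - 1) (lam - 1 / 2)) := by
      rw [ha]; ring
    rw [this]; exact (min_le_left _ _).trans (min_le_left _ _)
  have h2 : a / 2 ≤ k₁ - 1 / 2 := by
    have : a / 2 = min (min (p₁ - 1) (k₁ - 1 / 2)) (min (1 / τ - 1) (lam - 1 / 2)) := by
      rw [ha]; ring
    rw [this]; exact (min_le_left _ _).trans (min_le_right _ _)
  have h3 : a / 2 ≤ 1 / τ - 1 := by
    have : a / 2 = min (min (p₁ - 1) (k₁ - 1 / 2)) (min (1 / τ - 1) (lam - 1 / 2)) := by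
      rw [ha]; ring
    rw [this]; exact (min_le_right _ _).trans (min_le_left _ _)
  have h4 : a / 2 ≤ lam - 1 / 2 := by
    have : a / 2 = min (min (p₁ - 1) (k₁ - 1 / 2)) (min (1 / τ - 1) (lam - 1 / 2)) := by
      rw [ha]; ring
    rw [this]; exact (min_le_right _ _).trans (min_le_right _ _)
  have ha0 : 0 < a := by
    have hτ : 1 < 1 / τ := by rw [lt_div_iff₀ hτ0]; linarith
    rw [ha]
    refine mul_pos two_pos (lt_min (lt_min ?_ ?_) (lt_min ?_ ?_)) <;> linarith
  set B : ℝ := (C ^ 2 + M ^ 2) / (2 * a) with hB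
  have hBa : a * B = (C ^ 2 + M ^ 2) / 2 := by rw [hB]; field_simp
  have hVd : ∀ t, ∃ v, HasDerivAt V v t ∧ v ≤ -a * V t + a * B := by
    intro t
    have hfun : V = fun t => (1 / 2) * ((ξ₁ t) ^ 2 + (ξ₂ t) ^ 2 + (e₁ t) ^ 2 + (dtil t) ^ 2) :=
      funext hV
    have hd := (((((hξ₁ t).pow 2).add ((hξ₂ t).pow 2)).add ((he₁ t).pow 2)).add
      ((hdtil t).pow 2)).const_mul (1 / 2 : ℝ)
    refine ⟨_, by rw [hfun]; exact hd, ?_⟩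
    rw [hBa, hV t]
    have hc2 : c t ^ 2 ≤ C ^ 2 := sq_le_sq' (abs_le.mp (hc t)).1 (abs_le.mp (hc t)).2
    have hF2 : F t ^ 2 ≤ M ^ 2 := sq_le_sq' (abs_le.mp (hF t)).1 (abs_le.mp (hF t)).2
    have e1 := mul_le_mul_of_nonneg_right h1 (sq_nonneg (ξ₁ t))
    have e2 := mul_le_mul_of_nonneg_right h2 (sq_nonneg (ξ₂ t))
    have e3 := mul_le_mul_of_nonneg_right h3 (sq_nonneg (e₁ t))
    have e4 := mul_le_mul_of_nonneg_right h4 (sq_nonneg (dtil t))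
    have q1 := sq_nonneg (ξ₁ t - e₁ t)
    have q2 := sq_nonneg (ξ₁ t - c t)
    have q3 := sq_nonneg (ξ₂ t + dtil t)
    have q4 := sq_nonneg (e₁ t + F t)
    have hdiv : -(e₁ t) / τ = -(1 / τ) * e₁ t := by ring
    rw [hdiv]
    generalize 1 / τ = s at *
    norm_num
    nlinarith
  have hanti : Antitone (fun t => (V t - B) * Real.exp (a * t)) := by
    choose v hv hle using hVd
    have hW : ∀ t, HasDerivAt (fun t => (V t - B) * Real.exp (a * t))
        (v t * Real.exp (a * t) + (V t - B) * (Real.exp (a * t) * (a * 1))) t := fun t =>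
      ((hv t).sub_const B).mul (((hasDerivAt_id t).const_mul a).exp)
    refine antitone_of_deriv_nonpos (fun t => (hW t).differentiableAt) fun t => ?_
    rw [(hW t).deriv]
    have : v t * Real.exp (a * t) + (V t - B) * (Real.exp (a * t) * (a * 1))
      = (v t - (-a * V t + a * B)) * Real.exp (a * t) := by ring
    rw [this]
    exact mul_nonpos_of_nonpos_of_nonneg (by linarith [hle t]) (Real.exp_pos _).le
  have hbound : ∀ t, 0 ≤ t → V t ≤ V 0 * Real.exp (-a * t) + B * (1 - Real.exp (-a * t)) := by
    intro t ht
    have h := hanti ht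
    simp only [mul_zero, Real.exp_zero, mul_one] at h
    have h' := mul_le_mul_of_nonneg_right h (Real.exp_pos (-a * t)).le
    rw [mul_assoc, ← Real.exp_add] at h'
    have : a * t + -a * t = 0 := by ring
    rw [this, Real.exp_zero] at h'
    linarith
  refine ⟨ha0, hbound, ?_⟩
  have hlim : Tendsto (fun t => V 0 * Real.exp (-a * t) + B * (1 - Real.exp (-a * t))) atTop
      (nhds B) := by
    have h0 : Tendsto (fun t : ℝ => Real.exp (-a * t)) atTop (nhds 0) :=
      Real.tendsto_exp_atBot.comp (tendsto_id.const_mul_atTop_of_neg (by linarith))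
    have := (h0.const_mul (V 0)).add ((h0.const_sub 1).const_mul B)
    simpa using this
  rw [← hlim.limsup_eq]
  refine limsup_le_limsup ?_ ?_ hlim.isBoundedUnder_le
  · filter_upwards [eventually_ge_atTop 0] with t ht using hbound t ht
  · refine IsBoundedUnder.isCoboundedUnder_le ⟨0, ?_⟩
    refine eventually_map.mpr (Eventually.of_forall fun t => ?_)
    show 0 ≤ V t
    rw [hV t]; positivity
end

section
/- Let p₄, k₄, τ, C, M be positive real numbers. Let ξ₇, ξ₈, e₄ : ℝ → ℝ be differentiable functions and c, F : ℝ → ℝ functions with |c(t)| ≤ C and |F(t)| ≤ M for all t, such that for all t: ξ₇'(t) = -p₄·ξ₇(t) + ξ₈(t) + e₄(t) + c(t); ξ₈'(t) = -ξ₇(t) - k₄·ξ₈(t); e₄'(t) = -e₄(t)/τ - F(t). Define V(t) = ½·(ξ₇(t)² + ξ₈(t)² + e₄(t)²). Then for all t, V'(t) ≤ -(p₄ - 1)·ξ₇(t)² - k₄·ξ₈(t)² - (1/τ - 1)·e₄(t)² + (C² + M²)/2. -/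
/-- Closed-loop Lyapunov derivative inequality for the position (x-axis) loop of the
command-filtered backstepping controller. -/
theorem position_lyapunov_inequality
    (p₄ k₄ τ C M : ℝ)
    (hp₄ : 0 < p₄) (hk₄ : 0 < k₄) (hτ : 0 < τ) (hC : 0 < C) (hM : 0 < M)
    (ξ₇ ξ₈ e₄ : ℝ → ℝ) (c F : ℝ → ℝ)
    (hc : ∀ t, |c t| ≤ C) (hF : ∀ t, |F t| ≤ M)
    (hξ₇ : ∀ t, HasDerivAt ξ₇ (-p₄ * ξ₇ t + ξ₈ t + e₄ t + c t) t)
    (hξ₈ : ∀ t, HasDerivAt ξ₈ (-(ξ₇ t) - k₄ * ξ₈ t) t)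
    (he₄ : ∀ t, HasDerivAt e₄ (-(e₄ t) / τ - F t) t)
    (V : ℝ → ℝ)
    (hV : ∀ t, V t = (1 / 2) * ((ξ₇ t) ^ 2 + (ξ₈ t) ^ 2 + (e₄ t) ^ 2)) :
    ∀ t, deriv V t ≤ -(p₄ - 1) * (ξ₇ t) ^ 2 - k₄ * (ξ₈ t) ^ 2
      - (1 / τ - 1) * (e₄ t) ^ 2 + (C ^ 2 + M ^ 2) / 2 := by
  intro t
  have hVf : V = fun t => (1 / 2) * ((ξ₇ t) ^ 2 + (ξ₈ t) ^ 2 + (e₄ t) ^ 2) := funext hV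
  have hd := ((((hξ₇ t).pow 2).add ((hξ₈ t).pow 2)).add ((he₄ t).pow 2)).const_mul (1 / 2 : ℝ)
  have hd2 : HasDerivAt V (-p₄ * ξ₇ t ^ 2 + ξ₇ t * e₄ t + ξ₇ t * c t - k₄ * ξ₈ t ^ 2
      - 1 / τ * e₄ t ^ 2 - e₄ t * F t) t := by
    rw [hVf]
    refine hd.congr_deriv ?_
    push_cast
    ring
  rw [hd2.deriv]
  have h1 : c t ^ 2 ≤ C ^ 2 := sq_le_sq' (abs_le.mp (hc t)).1 (abs_le.mp (hc t)).2
  have h2 : F t ^ 2 ≤ M ^ 2 := sq_le_sq' (abs_le.mp (hF t)).1 (abs_le.mp (hF t)).2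
  linarith [sq_nonneg (ξ₇ t - e₄ t), sq_nonneg (ξ₇ t - c t), sq_nonneg (e₄ t + F t)]
end

section
/- Let m > 0, g ∈ ℝ, and U_x, U_y, U_z, ψ ∈ ℝ with U_z + g > 0. Define θ_d = arctan((U_x·cos ψ + U_y·sin ψ)/(U_z + g)), φ_d = arctan(((U_x·sin ψ - U_y·cos ψ)·cos θ_d)/(U_z + g)), and U_p = m·(U_z + g)/(cos φ_d · cos θ_d). Then (cos φ_d · sin θ_d · cos ψ + sin φ_d · sin ψ)·U_p/m = U_x. -/
open Real

/-- Exactness of the control-allocation formulas for the x-axis translational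
channel of the quadrotor: with `θ_d`, `φ_d` and `U_p` defined from the virtual
controls `U_x, U_y, U_z` and desired yaw `ψ`, one has
`(cos φ_d · sin θ_d · cos ψ + sin φ_d · sin ψ)·U_p/m = U_x`. -/
theorem control_allocation_x
    (m g Ux Uy Uz ψ : ℝ) (hm : 0 < m) (hUz : 0 < Uz + g)
    (θd φd Up : ℝ)
    (hθd : θd = arctan ((Ux * cos ψ + Uy * sin ψ) / (Uz + g)))
    (hφd : φd = arctan (((Ux * sin ψ - Uy * cos ψ) * cos θd) / (Uz + g)))
    (hUp : Up = m * (Uz + g) / (cos φd * cos θd)) :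
    (cos φd * sin θd * cos ψ + sin φd * sin ψ) * Up / m = Ux := by
  have hc1 : 0 < cos θd := by rw [hθd]; exact cos_arctan_pos _
  have hc2 : 0 < cos φd := by rw [hφd]; exact cos_arctan_pos _
  have h1 : tan θd = (Ux * cos ψ + Uy * sin ψ) / (Uz + g) := by rw [hθd, tan_arctan]
  have h2 : tan φd = ((Ux * sin ψ - Uy * cos ψ) * cos θd) / (Uz + g) := by
    conv_lhs => rw [hφd, tan_arctan]
  rw [tan_eq_sin_div_cos, div_eq_div_iff hc1.ne' hUz.ne'] at h1
  rw [tan_eq_sin_div_cos, div_eq_div_iff hc2.ne' hUz.ne'] at h2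
  have h3 := sin_sq_add_cos_sq ψ
  clear hθd hφd
  rw [hUp, div_eq_iff hm.ne', ← mul_div_assoc, div_eq_iff (mul_pos hc2 hc1).ne']
  linear_combination m * cos φd * cos ψ * h1 + m * sin ψ * h2 +
    m * Ux * cos φd * cos θd * h3
end

section
/- Let m > 0, g ∈ ℝ, and U_x, U_y, U_z, ψ ∈ ℝ with U_z + g > 0. Define θ_d = arctan((U_x·cos ψ + U_y·sin ψ)/(U_z + g)), φ_d = arctan(((U_x·sin ψ - U_y·cos ψ)·cos θ_d)/(U_z + g)), and U_p = m·(U_z + g)/(cos φ_d · cos θ_d). Then (cos φ_d · sin θ_d · sin ψ - sin φ_d · cos ψ)·U_p/m = U_y. -/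
open Real

/-- Exactness of the control-allocation formulas for the y-axis translational
channel of the quadrotor: with `θ_d`, `φ_d` and `U_p` defined from the virtual
controls `U_x, U_y, U_z` and desired yaw `ψ`, one has
`(cos φ_d · sin θ_d · sin ψ - sin φ_d · cos ψ)·U_p/m = U_y`. -/
theorem control_allocation_y
    (m g Ux Uy Uz ψ : ℝ) (hm : 0 < m) (hUz : 0 < Uz + g)
    (θd φd Up : ℝ)
    (hθd : θd = arctan ((Ux * cos ψ + Uy * sin ψ) / (Uz + g)))
    (hφd : φd = arctan (((Ux * sin ψ - Uy * cos ψ) * cos θd) / (Uz + g)))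
    (hUp : Up = m * (Uz + g) / (cos φd * cos θd)) :
    (cos φd * sin θd * sin ψ - sin φd * cos ψ) * Up / m = Uy := by
  have hcθ : 0 < cos θd := by rw [hθd]; exact cos_arctan_pos _
  have hcφ : 0 < cos φd := by rw [hφd]; exact cos_arctan_pos _
  have htθ : sin θd / cos θd = (Ux * cos ψ + Uy * sin ψ) / (Uz + g) := by
    rw [← tan_eq_sin_div_cos, hθd, tan_arctan]
  have htφ : sin φd / cos φd = ((Ux * sin ψ - Uy * cos ψ) * cos θd) / (Uz + g) := by
    rw [← tan_eq_sin_div_cos]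
    conv_lhs => rw [hφd]
    rw [tan_arctan]
  rw [div_eq_div_iff hcθ.ne' hUz.ne'] at htθ
  rw [div_eq_div_iff hcφ.ne' hUz.ne'] at htφ
  have key : (cos φd * sin θd * sin ψ - sin φd * cos ψ) * (Uz + g)
      = Uy * (cos φd * cos θd) := by
    linear_combination cos φd * sin ψ * htθ - cos ψ * htφ
      + Uy * cos φd * cos θd * sin_sq_add_cos_sq ψ
  rw [hUp, div_eq_iff hm.ne', mul_div_assoc', div_eq_iff (mul_pos hcφ hcθ).ne']
  linear_combination m * key
end
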